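/- (Expansion of H·𝔼Â·Yᵀ·Y·𝔼Â·Hᵀ, Appendix D.) For every H ∈ ℝ^{d×N}: H · 𝔼Â · Yᵀ · Y · 𝔼Â · Hᵀ = 2n² · (Σ̃_B(H) − (4pq/(p+q)²) · Σ_B(H)). -/

import Mathlib

open Matrix Finset

noncomputable section

/-- Nodes for the two-class model: class index in `Fin 2`, within-class index in `Fin n`. -/
abbrev V2 (n : ℕ) := Fin 2 × Fin n

/-- Squared Frobenius norm. -/
def frobSq {m k : Type*} [Fintype m] [Fintype k] (M : Matrix m k ℝ) : ℝ :=
  ∑ i, ∑ j, (M i j) ^ 2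

/-- The expected normalized adjacency matrix `𝔼Â` of the two-class SSBM. -/
def EAmat (n : ℕ) (p q : ℝ) : Matrix (V2 n) (V2 n) ℝ :=
  Matrix.of fun u v => (if u.1 = v.1 then p else q) / ((n : ℝ) * (p + q))

/-- Target matrix `Y = I₂ ⊗ 1ₙᵀ`. -/
def Y2 (n : ℕ) : Matrix (Fin 2) (V2 n) ℝ :=
  Matrix.of fun c v => if v.1 = c then 1 else 0

/-- Class mean `h̄_c` of the columns of `H` in class `c`. -/
def classMean {n d : ℕ} (H : Matrix (Fin d) (V2 n) ℝ) (c : Fin 2) : Fin d → ℝ :=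
  fun r => (1 / (n : ℝ)) * ∑ j, H r (c, j)

/-- Global mean `h̄_G = (h̄₁ + h̄₂)/2`. -/
def globalMean {n d : ℕ} (H : Matrix (Fin d) (V2 n) ℝ) : Fin d → ℝ :=
  fun r => (classMean H 0 r + classMean H 1 r) / 2

/-- Between-class covariance `Σ_B(H) = ¼(h̄₁ − h̄₂)(h̄₁ − h̄₂)ᵀ`. -/
def SigmaB {n d : ℕ} (H : Matrix (Fin d) (V2 n) ℝ) : Matrix (Fin d) (Fin d) ℝ :=
  (1 / 4 : ℝ) • vecMulVec (classMean H 0 - classMean H 1) (classMean H 0 - classMean H 1)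

/-- Non-centered between-class covariance `Σ̃_B(H) = ½(h̄₁h̄₁ᵀ + h̄₂h̄₂ᵀ)`. -/
def SigmaBtilde {n d : ℕ} (H : Matrix (Fin d) (V2 n) ℝ) : Matrix (Fin d) (Fin d) ℝ :=
  (1 / 2 : ℝ) • (vecMulVec (classMean H 0) (classMean H 0)
    + vecMulVec (classMean H 1) (classMean H 1))

/-- Global-mean covariance `Σ_G(H) = h̄_G h̄_Gᵀ`. -/
def SigmaG {n d : ℕ} (H : Matrix (Fin d) (V2 n) ℝ) : Matrix (Fin d) (Fin d) ℝ :=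
  vecMulVec (globalMean H) (globalMean H)

/-- Within-class covariance `Σ_W(H)`. -/
def SigmaW {n d : ℕ} (H : Matrix (Fin d) (V2 n) ℝ) : Matrix (Fin d) (Fin d) ℝ :=
  (1 / (2 * (n : ℝ))) • ∑ c : Fin 2, ∑ j : Fin n,
    vecMulVec (fun r => H r (c, j) - classMean H c r) (fun r => H r (c, j) - classMean H c r)

theorem EAmat_transpose (n : ℕ) (p q : ℝ) : (EAmat n p q)ᵀ = EAmat n p q := by
  ext u v
  simp [EAmat, eq_comm]

/-- Aggregating over the expected graph and summing over class `c` mixes the two class means. -/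
theorem mul_EAmat_mul_Y2_transpose_apply {n d : ℕ} (hn : n ≠ 0) (p q : ℝ)
    (H : Matrix (Fin d) (V2 n) ℝ) (r : Fin d) (c : Fin 2) :
    (H * EAmat n p q * (Y2 n)ᵀ) r c =
      n * ((p * classMean H c r + q * classMean H (1 - c) r) / (p + q)) := by
  have hn' : (n : ℝ) ≠ 0 := Nat.cast_ne_zero.mpr hn
  fin_cases c <;>
    simp [Matrix.mul_apply, EAmat, Y2, classMean, Fintype.sum_prod_type, ← Finset.sum_mul] <;>
    field_simp <;> ring

/-- Expansion of `H·𝔼Â·Yᵀ·Y·𝔼Â·Hᵀ` (Appendix D). -/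
theorem H_EA_Yt_Y_EA_Ht_expansion
    (n d : ℕ) (hn : 1 ≤ n) (p q : ℝ) (hp : 0 ≤ p) (hq : 0 ≤ q) (hpq : 0 < p + q)
    (H : Matrix (Fin d) (V2 n) ℝ) :
    H * EAmat n p q * (Y2 n)ᵀ * (Y2 n * (EAmat n p q * Hᵀ)) =
      (2 * (n : ℝ) ^ 2) • (SigmaBtilde H - (4 * p * q / (p + q) ^ 2) • SigmaB H) := by
  have hn' : n ≠ 0 := Nat.one_le_iff_ne_zero.mp hn
  have hsum : p + q ≠ 0 := hpq.ne'
  have htr : Y2 n * (EAmat n p q * Hᵀ) = (H * EAmat n p q * (Y2 n)ᵀ)ᵀ := by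
    simp [Matrix.transpose_mul, EAmat_transpose]
  rw [htr]
  ext r s
  rw [Matrix.mul_apply]
  simp only [Fin.sum_univ_two, Matrix.transpose_apply, mul_EAmat_mul_Y2_transpose_apply hn',
    sub_zero, sub_self, SigmaBtilde, SigmaB, Matrix.smul_apply, Matrix.sub_apply,
    Matrix.add_apply, vecMulVec_apply, Pi.sub_apply, smul_eq_mul]
  field_simp
  ring

end
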